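/- Let f(x,y,z) = x² + y² + z² + 2(xz − xy + yz). Then f(x², y², z²) = (x − y + iz)(x − y − iz)(x + y + iz)(x + y − iz) in ℂ[x,y,z], the four linear forms are pairwise non-proportional, and no three of the four lines they define in ℙ²(ℂ) pass through a common point; hence the curve C̃₂ = {f(x²,y²,z²) = 0} is an arrangement of four lines in general position, with exactly 6 singular points, all ordinary double points. -/

import Mathlib

open MvPolynomial

noncomputable section

/-- The conic `f(x,y,z) = x² + y² + z² + 2(xz − xy + yz)`. -/
def fPoly : MvPolynomial (Fin 3) ℂ :=
  X 0 ^ 2 + X 1 ^ 2 + X 2 ^ 2 + 2 * (X 0 * X 2 - X 0 * X 1 + X 1 * X 2)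

/-- `F₂(x,y,z) = f(x², y², z²)`. -/
def F2 : MvPolynomial (Fin 3) ℂ :=
  bind₁ (fun i => X i ^ 2) fPoly

/-- The four linear factors `x − y + iz`, `x − y − iz`, `x + y + iz`, `x + y − iz`. -/
def linForm : Fin 4 → MvPolynomial (Fin 3) ℂ :=
  ![X 0 - X 1 + C Complex.I * X 2,
    X 0 - X 1 - C Complex.I * X 2,
    X 0 + X 1 + C Complex.I * X 2,
    X 0 + X 1 - C Complex.I * X 2]

instance : TopologicalSpace (Projectivization ℂ (Fin 3 → ℂ)) :=
  inferInstanceAs (TopologicalSpace (Quotient (projectivizationSetoid ℂ (Fin 3 → ℂ))))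

/-- The singular locus of the quartic `C̃₂ = {F₂ = 0} ⊆ ℙ²(ℂ)`. -/
def singLocusC2 : Set (Projectivization ℂ (Fin 3 → ℂ)) :=
  {p | eval p.rep F2 = 0 ∧ ∀ i : Fin 3, eval p.rep (pderiv i F2) = 0}

theorem F2_eq : F2 = linForm 0 * linForm 1 * linForm 2 * linForm 3 := by
  have hI : (C Complex.I : MvPolynomial (Fin 3) ℂ) ^ 2 = -1 := by
    rw [← map_pow, Complex.I_sq]; simp
  simp only [F2, fPoly, linForm, map_add, map_sub, map_mul, map_pow, bind₁_X_right, map_ofNat,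
    Matrix.cons_val]
  linear_combination (X 2 ^ 2 * (2 * X 0 ^ 2 + 2 * X 1 ^ 2) +
    X 2 ^ 4 * (1 - C Complex.I ^ 2)) * hI

theorem evalF (v : Fin 3 → ℂ) : eval v F2 = v 0 ^ 4 + v 1 ^ 4 + v 2 ^ 4 +
    2 * (v 0 ^ 2 * v 2 ^ 2 - v 0 ^ 2 * v 1 ^ 2 + v 1 ^ 2 * v 2 ^ 2) := by
  simp only [F2, fPoly, map_add, map_sub, map_mul, map_pow, bind₁_X_right, map_ofNat, eval_X]
  ring

theorem eval0 (v : Fin 3 → ℂ) : eval v (pderiv 0 F2) =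
    4 * v 0 * (v 0 ^ 2 + v 2 ^ 2 - v 1 ^ 2) := by
  have h2 : (2 : MvPolynomial (Fin 3) ℂ) = C 2 := (map_ofNat C 2).symm
  simp [F2, fPoly, pderiv_X, h2, Derivation.leibniz_pow]
  ring

theorem eval1 (v : Fin 3 → ℂ) : eval v (pderiv 1 F2) =
    4 * v 1 * (v 1 ^ 2 + v 2 ^ 2 - v 0 ^ 2) := by
  have h2 : (2 : MvPolynomial (Fin 3) ℂ) = C 2 := (map_ofNat C 2).symm
  simp [F2, fPoly, pderiv_X, h2, Derivation.leibniz_pow]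
  ring

theorem eval2 (v : Fin 3 → ℂ) : eval v (pderiv 2 F2) =
    4 * v 2 * (v 2 ^ 2 + v 0 ^ 2 + v 1 ^ 2) := by
  have h2 : (2 : MvPolynomial (Fin 3) ℂ) = C 2 := (map_ofNat C 2).symm
  simp [F2, fPoly, pderiv_X, h2, Derivation.leibniz_pow]
  ring

/-- Representatives of the six singular points. -/
def ptVec : Fin 6 → Fin 3 → ℂ :=
  ![![0, 1, Complex.I], ![0, 1, -Complex.I], ![1, 0, Complex.I], ![1, 0, -Complex.I],
    ![1, 1, 0], ![1, -1, 0]]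

theorem ptVec_ne (k : Fin 6) : ptVec k ≠ 0 := by
  intro h
  have h0 := congrFun h 0
  have h1 := congrFun h 1
  fin_cases k <;> simp [ptVec] at h0 h1

/-- The six singular points. -/
def pt (k : Fin 6) : Projectivization ℂ (Fin 3 → ℂ) := Projectivization.mk ℂ (ptVec k) (ptVec_ne k)

theorem pt_inj : Function.Injective pt := by
  intro j k h
  rw [pt, pt, Projectivization.mk_eq_mk_iff'] at h
  obtain ⟨a, h⟩ := h
  have h0 := congrFun h 0
  have h1 := congrFun h 1
  have h2 := congrFun h 2
  have hI : Complex.I ≠ -Complex.I := by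
    intro h; have := congrArg Complex.im h; norm_num at this
  have hI' : -Complex.I ≠ Complex.I := hI.symm
  have hm : (-1 : ℂ) ≠ 1 := by norm_num
  have hm' : (1 : ℂ) ≠ -1 := by norm_num
  fin_cases j <;> fin_cases k <;> first
    | rfl
    | (exfalso; simp [ptVec] at h0 h1 h2; done)
    | (exfalso; simp [ptVec] at h0 h1 h2; grind [Complex.I_ne_zero])

theorem singVec (v : Fin 3 → ℂ) (hv : v ≠ 0) (h0 : v 0 * (v 0 ^ 2 + v 2 ^ 2 - v 1 ^ 2) = 0)
    (h1 : v 1 * (v 1 ^ 2 + v 2 ^ 2 - v 0 ^ 2) = 0)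
    (h2 : v 2 * (v 2 ^ 2 + v 0 ^ 2 + v 1 ^ 2) = 0) :
    ∃ k, ∃ a : ℂ, a ≠ 0 ∧ v = a • ptVec k := by
  have hI := Complex.I_sq
  have fin (k : Fin 6) (a : ℂ) (e0 : v 0 = a * ptVec k 0) (e1 : v 1 = a * ptVec k 1)
      (e2 : v 2 = a * ptVec k 2) : ∃ k, ∃ a : ℂ, a ≠ 0 ∧ v = a • ptVec k := by
    have e : v = a • ptVec k := by
      ext i; fin_cases i <;> simpa
    refine ⟨k, a, ?_, e⟩
    rintro rfl
    exact hv (by simpa using e)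
  have zero (e0 : v 0 = 0) (e1 : v 1 = 0) (e2 : v 2 = 0) : False :=
    hv (by ext i; fin_cases i <;> simpa)
  by_cases hx : v 0 = 0
  · by_cases hy : v 1 = 0
    · exact (zero hx hy (by simpa [hx, hy] using h2)).elim
    · have : (v 2 - v 1 * Complex.I) * (v 2 + v 1 * Complex.I) = 0 := by
        have := (mul_eq_zero.1 h1).resolve_left hy
        rw [hx] at this
        linear_combination this - v 1 ^ 2 * hI
      rcases mul_eq_zero.1 this with h | h
      · exact fin 0 (v 1) (by simp [ptVec, hx]) (by simp [ptVec])
          (by simp [ptVec]; linear_combination h)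
      · exact fin 1 (v 1) (by simp [ptVec, hx]) (by simp [ptVec])
          (by simp [ptVec]; linear_combination h)
  · have hx' := (mul_eq_zero.1 h0).resolve_left hx
    by_cases hy : v 1 = 0
    · have : (v 2 - v 0 * Complex.I) * (v 2 + v 0 * Complex.I) = 0 := by
        rw [hy] at hx'
        linear_combination hx' - v 0 ^ 2 * hI
      rcases mul_eq_zero.1 this with h | h
      · exact fin 2 (v 0) (by simp [ptVec]) (by simp [ptVec, hy])
          (by simp [ptVec]; linear_combination h)
      · exact fin 3 (v 0) (by simp [ptVec]) (by simp [ptVec, hy])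
          (by simp [ptVec]; linear_combination h)
    · have hy' := (mul_eq_zero.1 h1).resolve_left hy
      have hz : v 2 = 0 := by
        have : v 2 ^ 2 = 0 := by linear_combination (hx' + hy') / 2
        simpa using this
      have : (v 1 - v 0) * (v 1 + v 0) = 0 := by
        rw [hz] at hy'
        linear_combination hy'
      rcases mul_eq_zero.1 this with h | h
      · exact fin 4 (v 0) (by simp [ptVec]) (by simp [ptVec]; linear_combination h)
          (by simp [ptVec, hz])
      · exact fin 5 (v 0) (by simp [ptVec]) (by simp [ptVec]; linear_combination h)
          (by simp [ptVec, hz])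

theorem sing_rep (p : Projectivization ℂ (Fin 3 → ℂ)) (hp : p ∈ singLocusC2) :
    ∃ k, ∃ a : ℂ, a ≠ 0 ∧ p.rep = a • ptVec k := by
  obtain ⟨-, h⟩ := hp
  have h0 := h 0
  have h1 := h 1
  have h2 := h 2
  rw [eval0] at h0
  rw [eval1] at h1
  rw [eval2] at h2
  exact singVec _ p.rep_nonzero (by linear_combination h0 / 4) (by linear_combination h1 / 4)
    (by linear_combination h2 / 4)

theorem sing_eq : singLocusC2 = Set.range pt := by
  ext p
  constructor
  · intro hp
    obtain ⟨k, a, ha, e⟩ := sing_rep p hp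
    refine ⟨k, ?_⟩
    rw [← p.mk_rep, pt, Projectivization.mk_eq_mk_iff']
    refine ⟨a⁻¹, ?_⟩
    rw [e, smul_smul, inv_mul_cancel₀ ha, one_smul]
  · rintro ⟨k, rfl⟩
    obtain ⟨a, e⟩ := (Projectivization.mk_eq_mk_iff' ℂ _ _ (pt k).rep_nonzero (ptVec_ne k)).1
      (pt k).mk_rep
    have hI := Complex.I_sq
    have hI4 := Complex.I_pow_four
    refine ⟨?_, fun i => ?_⟩
    · rw [evalF, ← e]
      fin_cases k <;> simp [ptVec, mul_pow, hI4] <;> grind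
    · fin_cases i
      · change eval _ (pderiv 0 F2) = 0
        rw [eval0, ← e]
        fin_cases k <;> simp [ptVec, mul_pow]
      · change eval _ (pderiv 1 F2) = 0
        rw [eval1, ← e]
        fin_cases k <;> simp [ptVec, mul_pow]
      · change eval _ (pderiv 2 F2) = 0
        rw [eval2, ← e]
        fin_cases k <;> simp [ptVec, mul_pow]

/-- Coefficient vectors of the four forms. -/
theorem evalL (v : Fin 3 → ℂ) (j : Fin 4) : eval v (linForm j) =
    ![v 0 - v 1 + Complex.I * v 2, v 0 - v 1 - Complex.I * v 2,
      v 0 + v 1 + Complex.I * v 2, v 0 + v 1 - Complex.I * v 2] j := by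
  fin_cases j <;> simp [linForm]

theorem nonprop (j j' : Fin 4) (hj : j ≠ j') : ¬ ∃ c : ℂ, linForm j' = C c * linForm j := by
  rintro ⟨c, h⟩
  have key (v : Fin 3 → ℂ) := congrArg (eval v) h
  simp only [map_mul, eval_C, evalL] at key
  have k0 := key ![1, 0, 0]
  have k1 := key ![0, 1, 0]
  have k2 := key ![0, 0, 1]
  have hI : Complex.I ≠ -Complex.I := by
    intro h; have := congrArg Complex.im h; norm_num at this
  have hI' : -Complex.I ≠ Complex.I := hI.symm
  have hm : (-1 : ℂ) ≠ 1 := by norm_num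
  have hm' : (1 : ℂ) ≠ -1 := by norm_num
  fin_cases j <;> fin_cases j' <;> first
    | exact hj rfl
    | (simp at k0; subst k0; simp at k1 k2; done)
    | (simp at k0; subst k0; simp at k1 k2; grind [Complex.I_ne_zero])

theorem noconc (j1 j2 j3 : Fin 4) (h12 : j1 ≠ j2) (h13 : j1 ≠ j3) (h23 : j2 ≠ j3) :
    ¬ ∃ v : Fin 3 → ℂ, v ≠ 0 ∧
        eval v (linForm j1) = 0 ∧ eval v (linForm j2) = 0 ∧ eval v (linForm j3) = 0 := by
  rintro ⟨v, hv, e1, e2, e3⟩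
  rw [evalL] at e1 e2 e3
  apply hv
  suffices h : v 0 = 0 ∧ v 1 = 0 ∧ Complex.I * v 2 = 0 by
    obtain ⟨a, b, c⟩ := h
    have c : v 2 = 0 := by simpa using c
    ext i; fin_cases i <;> simpa
  generalize Complex.I * v 2 = w at *
  generalize v 0 = x at *
  generalize v 1 = y at *
  clear hv
  fin_cases j1 <;> fin_cases j2 <;> first
    | exact absurd rfl h12
    | (fin_cases j3 <;> first
        | exact absurd rfl h13
        | exact absurd rfl h23
        | (simp at e1 e2 e3; clear h12 h13 h23; grind))

theorem two_lines (p : Projectivization ℂ (Fin 3 → ℂ)) (hp : p ∈ singLocusC2) :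
    ({j : Fin 4 | eval p.rep (linForm j) = 0}).ncard = 2 := by
  obtain ⟨k, a, ha, e⟩ := sing_rep p hp
  have key : ∃ j j' : Fin 4, j ≠ j' ∧ eval p.rep (linForm j) = 0 ∧
      eval p.rep (linForm j') = 0 := by
    have hI (b : ℂ) : Complex.I * (b * Complex.I) = -b := by
      linear_combination b * Complex.I_sq
    simp only [evalL, e]
    fin_cases k
    · exact ⟨1, 2, by decide, by simp [ptVec, hI], by simp [ptVec, hI]⟩
    · exact ⟨0, 3, by decide, by simp [ptVec, hI], by simp [ptVec, hI]⟩
    · exact ⟨0, 2, by decide, by simp [ptVec, hI], by simp [ptVec, hI]⟩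
    · exact ⟨1, 3, by decide, by simp [ptVec, hI], by simp [ptVec, hI]⟩
    · exact ⟨0, 1, by decide, by simp [ptVec, hI], by simp [ptVec, hI]⟩
    · exact ⟨2, 3, by decide, by simp [ptVec, hI], by simp [ptVec, hI]⟩
  obtain ⟨j, j', hj, e1, e2⟩ := key
  rw [Set.ncard_eq_two]
  refine ⟨j, j', hj, ?_⟩
  ext m
  simp only [Set.mem_ofPred_eq, Set.mem_insert_iff, Set.mem_singleton_iff]
  constructor
  · intro hm
    by_contra! hc
    exact noconc j j' m hj hc.1.symm hc.2.symm ⟨p.rep, p.rep_nonzero, e1, e2, hm⟩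
  · rintro (rfl | rfl) <;> assumption

/-- `f(x², y², z²) = (x − y + iz)(x − y − iz)(x + y + iz)(x + y − iz)`; the four linear forms
are pairwise non-proportional, no three of the corresponding lines of `ℙ²(ℂ)` are concurrent;
hence `C̃₂` is an arrangement of four lines in general position with exactly `6` singular
points, all ordinary double points (each singular point lies on exactly two of the lines). -/
theorem C2_four_lines_in_general_position :
    F2 = linForm 0 * linForm 1 * linForm 2 * linForm 3 ∧
    (∀ j j' : Fin 4, j ≠ j' → ¬ ∃ c : ℂ, linForm j' = C c * linForm j) ∧
    (∀ j1 j2 j3 : Fin 4, j1 ≠ j2 → j1 ≠ j3 → j2 ≠ j3 →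
      ¬ ∃ v : Fin 3 → ℂ, v ≠ 0 ∧
        eval v (linForm j1) = 0 ∧ eval v (linForm j2) = 0 ∧ eval v (linForm j3) = 0) ∧
    singLocusC2.ncard = 6 ∧
    (∀ p ∈ singLocusC2, ({j : Fin 4 | eval p.rep (linForm j) = 0}).ncard = 2) := by
  refine ⟨F2_eq, nonprop, noconc, ?_, two_lines⟩
  rw [sing_eq, ← Set.image_univ, Set.ncard_image_of_injective _ pt_inj, Set.ncard_univ]
  simp

end
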